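/- In a vertex algebra, with X_{z1,z2}(a⊗b) = e^{z2D} Y(a,z1−z2)b, expanding in the opposite region gives the opposite-order product on the vacuum: i_{z2;z1} X_{z1,z2}(a⊗b) = Y(b,z2) Y(a,z1) 1. -/

import Mathlib

/- Vertex algebra setup (coefficient formulation).
V is a ℂ-vector space with translation operator D and vacuum `vac`; the vertex
operators are given by their coefficients: `Y a b n` = coefficient of z^n in Y(a,z)b.
Axioms used as hypotheses:
 * field/truncation: `Y a b n = 0` for `n < -(Nf a b)`;
 * vacuum: `Y(1,z) = id` and `Y(a,z)1 = e^{zD}a` (coefficients `expCoeff D a n`);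
 * translation covariance: `[D,Y(a,z)] = ∂_z Y(a,z)`, coefficientwise
   `D (Y a b n) − Y a (D b) n = (n+1) • Y a b (n+1)`;
 * weak commutativity: for all a,b there is N with (z1−z2)^N [Y(a,z1),Y(b,z2)] = 0,
   stated coefficientwise using the binomial expansion of (z1−z2)^N.

X_{z1,z2}(a⊗b) := e^{z2 D} Y(a, z1−z2) b ∈ V[[z1,z2]][(z1−z2)^{-1}].  Elements of
that ring are faithfully represented by their expansions into formal distributions
(the expansion maps are injective), so identities in it are stated as identities of
expansion coefficients.
 * `X1coeff D Y a b m n` = coefficient of z1^m z2^n of i_{z1;z2} X_{z1,z2}(a⊗b),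
   expanding (z1−z2)^k (k ∈ ℤ) in the region |z1|>|z2| via generalized binomial
   coefficients `intChoose`;
 * `X2coeff D Y a b m n` = coefficient of z1^m z2^n of i_{z2;z1} X_{z1,z2}(a⊗b),
   expanding (z1−z2)^k in |z2|>|z1| (the j-sum over powers of D is finite by the
   truncation axiom; we use `finsum`). -/

noncomputable section
open Finset

noncomputable def expCoeff {V : Type*} [AddCommGroup V] [Module ℂ V]
    (D : Module.End ℂ V) (a : V) (n : ℤ) : V :=
  if 0 ≤ n then ((n.toNat.factorial : ℂ))⁻¹ • (D ^ n.toNat) a else 0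

/-- generalized binomial coefficient `k(k-1)⋯(k-l+1)/l!` for `k : ℤ` -/
noncomputable def intChoose (k : ℤ) (l : ℕ) : ℂ :=
  ((l.factorial : ℂ))⁻¹ * ∏ i ∈ Finset.range l, ((k : ℂ) - (i : ℂ))

/-- coefficient of z1^m z2^n in the |z1|>|z2| expansion of e^{z2 D} Y(a,z1−z2) b -/
noncomputable def X1coeff {V : Type*} [AddCommGroup V] [Module ℂ V]
    (D : Module.End ℂ V) (Y : V → V → ℤ → V) (a b : V) (m n : ℤ) : V :=
  if 0 ≤ n then
    ∑ j ∈ Finset.range (n.toNat + 1),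
      (((j.factorial : ℂ))⁻¹ * (-1 : ℂ) ^ (n.toNat - j) *
        intChoose (m + ((n.toNat - j : ℕ) : ℤ)) (n.toNat - j)) •
        (D ^ j) (Y a b (m + ((n.toNat - j : ℕ) : ℤ)))
  else 0

/-- coefficient of z1^m z2^n in the |z2|>|z1| expansion of e^{z2 D} Y(a,z1−z2) b -/
noncomputable def X2coeff {V : Type*} [AddCommGroup V] [Module ℂ V]
    (D : Module.End ℂ V) (Y : V → V → ℤ → V) (a b : V) (m n : ℤ) : V :=
  if 0 ≤ m then
    ∑ᶠ j : ℕ,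
      (((j.factorial : ℂ))⁻¹ * (-1 : ℂ) ^ (m + n - (j : ℤ)) * (-1 : ℂ) ^ m.toNat *
        intChoose (m + n - (j : ℤ)) m.toNat) •
        (D ^ j) (Y a b (m + n - (j : ℤ)))
  else 0


section Helpers

variable {V : Type*} [AddCommGroup V] [Module ℂ V]

/-- multiplication by `z1` -/
def sh1 (V : Type*) [AddCommGroup V] [Module ℂ V] : Module.End ℂ (ℤ → ℤ → V) where
  toFun K := fun m n => K (m - 1) n
  map_add' _ _ := rfl
  map_smul' _ _ := rfl

/-- multiplication by `z2` -/
def sh2 (V : Type*) [AddCommGroup V] [Module ℂ V] : Module.End ℂ (ℤ → ℤ → V) where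
  toFun K := fun m n => K m (n - 1)
  map_add' _ _ := rfl
  map_smul' _ _ := rfl

/-- multiplication by `z1 - z2` -/
def dl (V : Type*) [AddCommGroup V] [Module ℂ V] : Module.End ℂ (ℤ → ℤ → V) := sh1 V - sh2 V

/-- `D - ∂1` -/
def t1 (D : Module.End ℂ V) : Module.End ℂ (ℤ → ℤ → V) where
  toFun K := fun m n => D (K m n) - (m + 1) • K (m + 1) n
  map_add' K L := by
    funext m n
    simp only [Pi.add_apply, map_add, smul_add]
    abel
  map_smul' c K := by
    funext m n
    simp only [Pi.smul_apply, map_smul, smul_sub, RingHom.id_apply]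
    rw [smul_comm]

/-- `∂2` -/
def d2 (V : Type*) [AddCommGroup V] [Module ℂ V] : Module.End ℂ (ℤ → ℤ → V) where
  toFun K := fun m n => (n + 1) • K m (n + 1)
  map_add' K L := by
    funext m n
    simp only [Pi.add_apply, smul_add]
  map_smul' c K := by
    funext m n
    simp only [Pi.smul_apply, RingHom.id_apply]
    rw [smul_comm]

theorem dl_apply (K : ℤ → ℤ → V) (m n : ℤ) : dl V K m n = K (m - 1) n - K m (n - 1) := rfl

theorem t1_apply (D : Module.End ℂ V) (K : ℤ → ℤ → V) (m n : ℤ) :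
    t1 D K m n = D (K m n) - (m + 1) • K (m + 1) n := rfl

theorem d2_apply (K : ℤ → ℤ → V) (m n : ℤ) : d2 V K m n = (n + 1) • K m (n + 1) := rfl

theorem sh1_pow (N : ℕ) (K : ℤ → ℤ → V) (m n : ℤ) : (sh1 V ^ N) K m n = K (m - N) n := by
  induction N generalizing m with
  | zero => simp
  | succ N ih =>
    rw [pow_succ']
    change (sh1 V ^ N) K (m - 1) n = _
    rw [ih]
    congr 1
    push_cast
    ring

theorem sh2_pow (N : ℕ) (K : ℤ → ℤ → V) (m n : ℤ) : (sh2 V ^ N) K m n = K m (n - N) := by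
  induction N generalizing n with
  | zero => simp
  | succ N ih =>
    rw [pow_succ']
    change (sh2 V ^ N) K m (n - 1) = _
    rw [ih]
    congr 1
    push_cast
    ring

theorem dl_pow_apply (N : ℕ) (K : ℤ → ℤ → V) (m n : ℤ) :
    (dl V ^ N) K m n = ∑ l ∈ Finset.range (N + 1), ((-1 : ℂ) ^ l * (N.choose l : ℂ)) •
      K (m - ((N - l : ℕ) : ℤ)) (n - (l : ℤ)) := by
  have hc : Commute ((-1 : ℂ) • sh2 V) (sh1 V) := by
    apply Commute.smul_left
    rfl
  have h : dl V = (-1 : ℂ) • sh2 V + sh1 V := by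
    apply LinearMap.ext
    intro K
    funext m n
    change sh1 V K m n - sh2 V K m n = (-1 : ℂ) • sh2 V K m n + sh1 V K m n
    rw [neg_one_smul]
    abel
  rw [h, hc.add_pow, LinearMap.sum_apply, Finset.sum_apply, Finset.sum_apply]
  apply Finset.sum_congr rfl
  intro l hl
  have e : ((-1 : ℂ) • sh2 V) ^ l * sh1 V ^ (N - l) *
      ((N.choose l : ℕ) : Module.End ℂ (ℤ → ℤ → V))
      = ((-1 : ℂ) ^ l * (N.choose l : ℂ)) • (sh2 V ^ l * sh1 V ^ (N - l)) := by
    rw [← (Nat.cast_commute (N.choose l) _).eq, ← nsmul_eq_mul, ← Nat.cast_smul_eq_nsmul ℂ,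
      smul_pow, mul_smul, smul_comm, smul_mul_assoc, smul_comm]
  rw [e, LinearMap.smul_apply, Pi.smul_apply, Pi.smul_apply, Module.End.mul_apply, sh2_pow, sh1_pow]

theorem dl_t1 (D : Module.End ℂ V) (K : ℤ → ℤ → V) :
    dl V (t1 D K) = t1 D (dl V K) + K := by
  funext m n
  simp only [dl_apply, t1_apply, Pi.add_apply, map_sub, smul_sub, sub_add_cancel, add_sub_cancel_right]
  rw [add_smul m 1 (K m n), one_smul]
  abel

theorem dl_T (D : Module.End ℂ V) (K : ℤ → ℤ → V) :
    dl V (t1 D K - d2 V K) = t1 D (dl V K) - d2 V (dl V K) := by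
  rw [map_sub, dl_t1]
  funext m n
  simp only [dl_apply, t1_apply, d2_apply, Pi.add_apply, Pi.sub_apply, map_sub, smul_sub,
    sub_add_cancel, add_sub_cancel_right]
  rw [add_smul n 1 (K m n), one_smul]
  abel

theorem dl_pow_T (D : Module.End ℂ V) (N : ℕ) (K : ℤ → ℤ → V) (h : t1 D K - d2 V K = 0) :
    t1 D ((dl V ^ N) K) - d2 V ((dl V ^ N) K) = 0 := by
  induction N with
  | zero => simpa using h
  | succ N ih =>
    rw [pow_succ', Module.End.mul_apply, ← dl_T, ih, map_zero]

theorem dl_pow_t1 (D : Module.End ℂ V) (N : ℕ) (K : ℤ → ℤ → V) (h : (dl V ^ N) K = 0) :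
    (dl V ^ (N + 1)) (t1 D K) = 0 := by
  induction N generalizing K with
  | zero =>
    have : K = 0 := by simpa using h
    simp [this]
  | succ N ih =>
    rw [pow_succ, Module.End.mul_apply, dl_t1, map_add, h, add_zero]
    apply ih
    rw [← Module.End.mul_apply, ← pow_succ, h]

theorem dl_pow_mono {N M : ℕ} (hNM : N ≤ M) (K : ℤ → ℤ → V) (h : (dl V ^ N) K = 0) :
    (dl V ^ M) K = 0 := by
  obtain ⟨k, rfl⟩ := Nat.exists_eq_add_of_le hNM
  rw [add_comm, pow_add, Module.End.mul_apply, h, map_zero]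

theorem dl_inj (K : ℤ → ℤ → V) (hs : ∀ m n, m < 0 → K m n = 0) (h : dl V K = 0) : K = 0 := by
  have key : ∀ k : ℕ, ∀ n, K ((k : ℤ) - 1) n = 0 := by
    intro k
    induction k with
    | zero => intro n; exact hs _ _ (by norm_num)
    | succ k ih =>
      intro n
      have := congrFun (congrFun h k) (n + 1)
      rw [dl_apply, ih, add_sub_cancel_right] at this
      push_cast
      rw [add_sub_cancel_right]
      simpa using this
  funext m n
  rcases lt_or_ge m 0 with hm | hm
  · exact hs _ _ hm
  · have := key (m + 1).toNat n
    rwa [Int.toNat_of_nonneg (by omega), add_sub_cancel_right] at this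

theorem dl_supp (K : ℤ → ℤ → V) (hs : ∀ m n, m < 0 → K m n = 0) :
    ∀ m n, m < 0 → dl V K m n = 0 := by
  intro m n hm
  rw [dl_apply, hs _ _ (by omega), hs _ _ hm, sub_zero]

theorem dl_pow_inj (N : ℕ) (K : ℤ → ℤ → V) (hs : ∀ m n, m < 0 → K m n = 0)
    (h : (dl V ^ N) K = 0) : K = 0 := by
  induction N generalizing K with
  | zero => simpa using h
  | succ N ih =>
    rw [pow_succ, Module.End.mul_apply] at h
    exact dl_inj K hs (ih _ (dl_supp K hs) h)

theorem dl_pow_quad (N : ℕ) (K : ℤ → ℤ → V) (hs : ∀ m n, m < 0 → n < 0 → K m n = 0)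
    (h : (dl V ^ N) K = 0) : ∀ m n, m + n < -(N : ℤ) → K m n = 0 := by
  induction N generalizing K with
  | zero =>
    have : K = 0 := by simpa using h
    simp [this]
  | succ N ih =>
    rw [pow_succ, Module.End.mul_apply] at h
    have h1 := ih (dl V K) (by
      intro m n hm hn
      rw [dl_apply, hs _ _ (by omega) hn, hs _ _ hm (by omega), sub_zero]) h
    intro m n hmn
    push_cast at hmn
    have h2 : ∀ t, K t (m + n - t) = K (t + 1) (m + n - (t + 1)) := by
      intro t
      have := h1 (t + 1) (m + n - t) (by omega)
      rw [dl_apply, add_sub_cancel_right, sub_eq_zero] at this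
      rw [this]
      congr 1
      ring
    have h3 : ∀ t, K (t - 1) (m + n - (t - 1)) = 0 := by
      intro t
      induction t using Int.induction_on with
      | zero => exact hs _ _ (by omega) (by omega)
      | succ k ih =>
        rw [h2] at ih
        have e : (k : ℤ) + 1 - 1 = k - 1 + 1 := by ring
        rw [e, ih]
      | pred k ih =>
        rw [h2]
        have e : -(k : ℤ) - 1 - 1 + 1 = -k - 1 := by ring
        rw [e, ih]
    have := h3 (m + 1)
    simpa using this

theorem dl_pow_m0 (N : ℕ) (K : ℤ → ℤ → V) (hs : ∀ m n, m < 0 → K m n = 0) :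
    (∀ m n, m < 0 → (dl V ^ N) K m n = 0) ∧
    ∀ n, (dl V ^ N) K 0 n = (-1 : ℂ) ^ N • K 0 (n - N) := by
  induction N with
  | zero => simpa using hs
  | succ N ih =>
    rw [pow_succ', Module.End.mul_apply]
    refine ⟨dl_supp _ ih.1, fun n => ?_⟩
    rw [dl_apply, ih.1 _ _ (by norm_num), ih.2, pow_succ, mul_neg_one, neg_smul, zero_sub]
    congr 3
    push_cast
    ring

theorem dl_pow_n0 (N : ℕ) (K : ℤ → ℤ → V) (hs : ∀ m n, n < 0 → K m n = 0) :
    (∀ m n, n < 0 → (dl V ^ N) K m n = 0) ∧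
    ∀ m, (dl V ^ N) K m 0 = K (m - N) 0 := by
  induction N with
  | zero => simpa using hs
  | succ N ih =>
    rw [pow_succ', Module.End.mul_apply]
    refine ⟨fun m n hn => ?_, fun m => ?_⟩
    · rw [dl_apply, ih.1 _ _ hn, ih.1 _ _ (by omega), sub_zero]
    · rw [dl_apply, ih.1 _ _ (show (0 : ℤ) - 1 < 0 by norm_num), ih.2, sub_zero]
      congr 1
      push_cast
      ring

theorem intChoose_succ (k : ℤ) (l : ℕ) :
    ((l : ℂ) + 1) * intChoose k (l + 1) = ((k : ℂ) - l) * intChoose k l := by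
  unfold intChoose
  rw [Finset.prod_range_succ, Nat.factorial_succ]
  have : ((l : ℂ) + 1) ≠ 0 := Nat.cast_add_one_ne_zero l
  have h2 : ((l.factorial : ℕ) : ℂ) ≠ 0 := Nat.cast_ne_zero.mpr (Nat.factorial_ne_zero l)
  push_cast
  field_simp

theorem intChoose_zero (k : ℤ) : intChoose k 0 = 1 := by simp [intChoose]

theorem intChoose_self (k : ℕ) : intChoose k k = 1 := by
  unfold intChoose
  have h : ∏ i ∈ Finset.range k, (((k : ℤ) : ℂ) - (i : ℂ)) = (k.factorial : ℂ) := by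
    rw [← Finset.prod_range_add_one_eq_factorial, ← Finset.prod_range_reflect]
    push_cast
    apply Finset.prod_congr rfl
    intro i hi
    have := Finset.mem_range.mp hi
    have e : k = (k - 1 - i) + i + 1 := by omega
    have e2 : (k : ℂ) = ((k - 1 - i : ℕ) : ℂ) + i + 1 := by exact_mod_cast e
    rw [e2]
    ring
  rw [h]
  exact inv_mul_cancel₀ (Nat.cast_ne_zero.mpr (Nat.factorial_ne_zero k))

theorem intChoose_lt (k l : ℕ) (h : k < l) : intChoose k l = 0 := by
  unfold intChoose
  rw [Finset.prod_eq_zero (Finset.mem_range.mpr h), mul_zero]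
  simp

/-- one term of `X2coeff` -/
def x2t (D : Module.End ℂ V) (A : ℤ → V) (m : ℕ) (n : ℤ) (j : ℕ) : V :=
  (((j.factorial : ℂ))⁻¹ * (-1 : ℂ) ^ ((m : ℤ) + n - (j : ℤ)) * (-1 : ℂ) ^ m *
        intChoose ((m : ℤ) + n - (j : ℤ)) m) • (D ^ j) (A ((m : ℤ) + n - (j : ℤ)))

theorem X2_eq_sum (D : Module.End ℂ V) (Y : V → V → ℤ → V) (a b : V) (M : ℕ)
    (hM : ∀ n : ℤ, n < -(M : ℤ) → Y a b n = 0) (m : ℕ) (n : ℤ) (J : ℕ)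
    (hJ : (m : ℤ) + n + M < J) :
    X2coeff D Y a b m n = ∑ j ∈ Finset.range J, x2t D (Y a b) m n j := by
  unfold X2coeff
  rw [if_pos (by positivity), Int.toNat_natCast]
  apply finsum_eq_sum_of_support_subset
  intro j hj
  by_contra hj2
  simp only [Finset.coe_range, Set.mem_Iio, not_lt] at hj2
  apply hj
  change _ • (D ^ j) (Y a b ((m : ℤ) + n - (j : ℤ))) = 0
  rw [hM _ (by omega), map_zero, smul_zero]

theorem x2t_rec (D : Module.End ℂ V) (A : ℤ → V) (m : ℕ) (n : ℤ) (J : ℕ) :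
    ((m : ℤ) + 1) • ∑ j ∈ Finset.range (J + 1), x2t D A (m + 1) n j =
      D (∑ j ∈ Finset.range J, x2t D A m n j)
        - (n + 1) • ∑ j ∈ Finset.range (J + 1), x2t D A m (n + 1) j := by
  have h : D (∑ j ∈ Finset.range J, x2t D A m n j) =
      ∑ j ∈ Finset.range (J + 1), (j : ℂ) • x2t D A m (n + 1) j := by
    rw [Finset.sum_range_succ', map_sum]
    simp only [Nat.cast_zero, zero_smul, add_zero]
    apply Finset.sum_congr rfl
    intro j _
    unfold x2t
    have e : (m : ℤ) + (n + 1) - ((j + 1 : ℕ) : ℤ) = m + n - j := by push_cast; ring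
    rw [e, map_smul, smul_smul, pow_succ', Module.End.mul_apply, Nat.factorial_succ]
    congr 1
    have h1 : ((j : ℂ) + 1) ≠ 0 := Nat.cast_add_one_ne_zero j
    push_cast
    field_simp
  rw [h, Finset.smul_sum, Finset.smul_sum, ← Finset.sum_sub_distrib]
  apply Finset.sum_congr rfl
  intro j _
  unfold x2t
  have e : ((m + 1 : ℕ) : ℤ) + n - (j : ℤ) = m + (n + 1) - j := by push_cast; ring
  rw [e, ← Int.cast_smul_eq_zsmul ℂ, ← Int.cast_smul_eq_zsmul ℂ, smul_smul, smul_smul, smul_smul,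
    ← sub_smul]
  congr 1
  have := intChoose_succ ((m : ℤ) + (n + 1) - j) m
  push_cast at this ⊢
  rw [pow_succ]
  linear_combination (-((j.factorial : ℂ))⁻¹ * (-1 : ℂ) ^ ((m : ℤ) + (n + 1) - (j : ℤ)) * (-1 : ℂ) ^ m) * this

theorem X2_rec (D : Module.End ℂ V) (Y : V → V → ℤ → V) (a b : V) (M : ℕ)
    (hM : ∀ n : ℤ, n < -(M : ℤ) → Y a b n = 0) (m : ℕ) (n : ℤ) :
    ((m : ℤ) + 1) • X2coeff D Y a b (m + 1) n =
      D (X2coeff D Y a b m n) - (n + 1) • X2coeff D Y a b m (n + 1) := by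
  obtain ⟨J, hJ⟩ : ∃ J : ℕ, (m : ℤ) + n + M < J := ⟨((m : ℤ) + n + M + 1).toNat, by omega⟩
  have h1 := X2_eq_sum D Y a b M hM (m + 1) n (J + 1) (by push_cast; omega)
  push_cast at h1
  rw [h1, X2_eq_sum D Y a b M hM m n J hJ,
    X2_eq_sum D Y a b M hM m (n + 1) (J + 1) (by push_cast; omega)]
  exact x2t_rec D (Y a b) m n J

theorem zsmul_cancel {k : ℤ} (hk : k ≠ 0) {x y : V} (h : k • x = k • y) : x = y := by
  rw [← Int.cast_smul_eq_zsmul ℂ, ← Int.cast_smul_eq_zsmul ℂ] at h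
  exact smul_right_injective V (Int.cast_ne_zero.mpr hk : (k : ℂ) ≠ 0) h

/-- `X2coeff` agrees with any solution with the same `z1^0` part. -/
theorem X2_unique (D : Module.End ℂ V) (Y : V → V → ℤ → V) (a b : V) (M : ℕ)
    (hM : ∀ n : ℤ, n < -(M : ℤ) → Y a b n = 0) (G : ℤ → ℤ → V)
    (hG : t1 D G - d2 V G = 0) (h0 : ∀ n, X2coeff D Y a b 0 n = G 0 n) (m : ℕ) (n : ℤ) :
    X2coeff D Y a b m n = G m n := by
  induction m generalizing n with
  | zero => exact h0 n
  | succ m ih =>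
    have h1 := X2_rec D Y a b M hM m n
    have h2 := congrFun (congrFun hG m) n
    simp only [Pi.sub_apply, t1_apply, d2_apply, Pi.zero_apply] at h2
    rw [ih, ih] at h1
    push_cast
    apply zsmul_cancel (show (m : ℤ) + 1 ≠ 0 by omega)
    rw [h1]
    rw [sub_eq_zero] at h2
    rw [← h2]
    abel

/-- `X2coeff` of a series without poles agrees with any solution with the same `z2^0` part. -/
theorem X2_unique' (D : Module.End ℂ V) (Y : V → V → ℤ → V) (a b : V)
    (hM : ∀ n : ℤ, n < 0 → Y a b n = 0) (H : ℤ → ℤ → V)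
    (hH : t1 D H - d2 V H = 0) (h0 : ∀ m : ℕ, H m 0 = Y a b m) (m n : ℕ) :
    X2coeff D Y a b m n = H m n := by
  have hM' : ∀ n : ℤ, n < -((0 : ℕ) : ℤ) → Y a b n = 0 := by simpa using hM
  induction n generalizing m with
  | zero =>
    push_cast
    rw [h0, X2_eq_sum D Y a b 0 hM' m 0 (m + 1) (by push_cast; omega), Finset.sum_eq_single 0]
    · unfold x2t
      simp only [Nat.cast_zero, add_zero, sub_zero, intChoose_self]
      simp [← mul_pow]
    · intro j hj hj0
      have : j ≤ m := by simpa [Nat.lt_succ_iff] using hj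
      unfold x2t
      have e : (m : ℤ) + 0 - j = ((m - j : ℕ) : ℤ) := by omega
      rw [e, intChoose_lt _ _ (by omega), mul_zero, zero_smul]
    · simp
  | succ n ih =>
    have h1 := X2_rec D Y a b 0 hM' m n
    have h2 := congrFun (congrFun hH m) n
    simp only [Pi.sub_apply, t1_apply, d2_apply, Pi.zero_apply] at h2
    have ih1 := ih (m + 1)
    push_cast at ih1
    rw [ih, ih1] at h1
    push_cast
    apply zsmul_cancel (show (n : ℤ) + 1 ≠ 0 by omega)
    rw [sub_eq_zero] at h2
    rw [← h2, h1]
    abel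

/-- coefficients of `Y(b,z2) Y(a,z1) 1` -/
def gg (Y : V → V → ℤ → V) (vac a b : V) : ℤ → ℤ → V := fun m n => Y b (Y a vac m) n

/-- coefficients of `Y(a,z1) Y(b,z2) 1` -/
def ff (Y : V → V → ℤ → V) (vac a b : V) : ℤ → ℤ → V := fun m n => Y a (Y b vac n) m

theorem expCoeff_neg (D : Module.End ℂ V) (a : V) {n : ℤ} (hn : n < 0) : expCoeff D a n = 0 := by
  unfold expCoeff
  rw [if_neg (by omega)]

theorem expCoeff_zero (D : Module.End ℂ V) (a : V) : expCoeff D a 0 = a := by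
  simp [expCoeff]

theorem expCoeff_one (D : Module.End ℂ V) (a : V) : expCoeff D a 1 = D a := by
  simp [expCoeff]

theorem expCoeff_D (D : Module.End ℂ V) (a : V) (n : ℤ) :
    expCoeff D (D a) n = D (expCoeff D a n) := by
  unfold expCoeff
  split_ifs
  · rw [map_smul, ← Module.End.mul_apply, ← Module.End.mul_apply, ← pow_succ, ← pow_succ']
  · rw [map_zero]

theorem Y_zero_neg
    (D : Module.End ℂ V) (Y : V → V → ℤ → V) (Nf : V → V → ℕ)
    (hfield : ∀ (a b : V) (n : ℤ), n < -(Nf a b : ℤ) → Y a b n = 0)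
    (htrans : ∀ (a b : V) (n : ℤ),
      D (Y a b n) - Y a (D b) n = (n + 1) • Y a b (n + 1))
    (a : V) (n : ℤ) (hn : n < 0) : Y a 0 n = 0 := by
  have key : ∀ k : ℕ, -(Nf a 0 : ℤ) - 1 + k < 0 → Y a 0 (-(Nf a 0 : ℤ) - 1 + k) = 0 := by
    intro k
    induction k with
    | zero => intro _; exact hfield _ _ _ (by push_cast; omega)
    | succ k ih =>
      intro hk
      push_cast at hk ⊢
      have h := htrans a 0 (-(Nf a 0 : ℤ) - 1 + k)
      rw [map_zero, ih (by omega), map_zero, sub_zero] at h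
      rw [← add_assoc]
      apply zsmul_cancel (show (-(Nf a 0 : ℤ) - 1 + k) + 1 ≠ 0 by omega)
      rw [← h, smul_zero]
  rcases lt_or_ge n (-(Nf a 0 : ℤ)) with h | h
  · exact hfield _ _ _ h
  · have e : n = -(Nf a 0 : ℤ) - 1 + ((n + Nf a 0 + 1).toNat : ℕ) := by omega
    rw [e]
    exact key _ (by omega)

theorem Y_zero
    (D : Module.End ℂ V) (vac : V) (Y : V → V → ℤ → V) (Nf : V → V → ℕ)
    (hfield : ∀ (a b : V) (n : ℤ), n < -(Nf a b : ℤ) → Y a b n = 0)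
    (hvacRight : ∀ (a : V) (n : ℤ), Y a vac n = expCoeff D a n)
    (htrans : ∀ (a b : V) (n : ℤ),
      D (Y a b n) - Y a (D b) n = (n + 1) • Y a b (n + 1))
    (hloc : ∀ a b : V, ∃ N : ℕ, (dl V ^ N) (ff Y vac a b - gg Y vac a b) = 0)
    (a : V) (m : ℤ) : Y a 0 m = 0 := by
  obtain ⟨N, hN⟩ := hloc a a
  have hneg := Y_zero_neg D Y Nf hfield htrans
  have hq := dl_pow_quad N _ (by
    intro m n hm hn
    simp only [Pi.sub_apply, ff, gg]
    rw [hvacRight, hvacRight, expCoeff_neg D a hm, expCoeff_neg D a hn, hneg _ _ hm, hneg _ _ hn,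
      sub_zero]) hN
  obtain ⟨n, h1, h2, h3⟩ : ∃ n : ℤ, n < 0 ∧ m + n < -(N : ℤ) ∧
      n < -(Nf a (Y a vac m) : ℤ) := by
    refine ⟨min (-1) (min (-(N : ℤ) - m - 1) (-(Nf a (Y a vac m) : ℤ) - 1)), ?_, ?_, ?_⟩ <;> omega
  have h := hq m n h2
  simp only [Pi.sub_apply, ff, gg] at h
  rw [hfield a (Y a vac m) n h3, sub_zero, hvacRight, expCoeff_neg D a h1] at h
  exact h

theorem gg_supp
    (D : Module.End ℂ V) (vac : V) (Y : V → V → ℤ → V) (Nf : V → V → ℕ)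
    (hfield : ∀ (a b : V) (n : ℤ), n < -(Nf a b : ℤ) → Y a b n = 0)
    (hvacRight : ∀ (a : V) (n : ℤ), Y a vac n = expCoeff D a n)
    (htrans : ∀ (a b : V) (n : ℤ),
      D (Y a b n) - Y a (D b) n = (n + 1) • Y a b (n + 1))
    (hloc : ∀ a b : V, ∃ N : ℕ, (dl V ^ N) (ff Y vac a b - gg Y vac a b) = 0)
    (a b : V) (m n : ℤ) (hm : m < 0) : gg Y vac a b m n = 0 := by
  unfold gg
  rw [hvacRight, expCoeff_neg D a hm]
  exact Y_zero D vac Y Nf hfield hvacRight htrans hloc _ _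

theorem gg_D
    (D : Module.End ℂ V) (vac : V) (Y : V → V → ℤ → V) (Nf : V → V → ℕ)
    (hfield : ∀ (a b : V) (n : ℤ), n < -(Nf a b : ℤ) → Y a b n = 0)
    (hvacRight : ∀ (a : V) (n : ℤ), Y a vac n = expCoeff D a n)
    (htrans : ∀ (a b : V) (n : ℤ),
      D (Y a b n) - Y a (D b) n = (n + 1) • Y a b (n + 1))
    (hloc : ∀ a b : V, ∃ N : ℕ, (dl V ^ N) (ff Y vac a b - gg Y vac a b) = 0)
    (a b : V) : gg Y vac a (D b) = t1 D (gg Y vac a b) := by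
  have hs := gg_supp D vac Y Nf hfield hvacRight htrans hloc
  have hF : ff Y vac a (D b) = t1 D (ff Y vac a b) := by
    funext m n
    rw [t1_apply]
    unfold ff
    rw [hvacRight, hvacRight, expCoeff_D, ← htrans]
    abel
  obtain ⟨N, hN⟩ := hloc a b
  obtain ⟨N', hN'⟩ := hloc a (D b)
  have h1 := dl_pow_t1 D N _ hN
  have h2 := dl_pow_mono (show N + 1 ≤ N + 1 + N' by omega) _ h1
  have h3 := dl_pow_mono (show N' ≤ N + 1 + N' by omega) _ hN'
  rw [map_sub, ← hF] at h2
  have h4 : (dl V ^ (N + 1 + N')) (gg Y vac a (D b) - t1 D (gg Y vac a b)) = 0 := by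
    have e : gg Y vac a (D b) - t1 D (gg Y vac a b) =
      (ff Y vac a (D b) - t1 D (gg Y vac a b)) - (ff Y vac a (D b) - gg Y vac a (D b)) := by abel
    rw [e, map_sub, h2, h3, sub_zero]
  have h5 := dl_pow_inj _ _ (by
    intro m n hm
    rw [Pi.sub_apply, Pi.sub_apply, t1_apply, hs _ _ _ _ hm, hs _ _ _ _ hm, map_zero]
    rcases eq_or_ne m (-1) with h | h
    · simp [h]
    · rw [hs _ _ _ _ (by omega)]
      simp) h4
  exact sub_eq_zero.mp h5

theorem Y_D_left
    (D : Module.End ℂ V) (vac : V) (Y : V → V → ℤ → V) (Nf : V → V → ℕ)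
    (hfield : ∀ (a b : V) (n : ℤ), n < -(Nf a b : ℤ) → Y a b n = 0)
    (hvacRight : ∀ (a : V) (n : ℤ), Y a vac n = expCoeff D a n)
    (htrans : ∀ (a b : V) (n : ℤ),
      D (Y a b n) - Y a (D b) n = (n + 1) • Y a b (n + 1))
    (hloc : ∀ a b : V, ∃ N : ℕ, (dl V ^ N) (ff Y vac a b - gg Y vac a b) = 0)
    (a b : V) (n : ℤ) : Y (D b) a n = (n + 1) • Y b a (n + 1) := by
  have h := congrFun (congrFun (gg_D D vac Y Nf hfield hvacRight htrans hloc a b) 0) n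
  rw [t1_apply] at h
  simp only [gg, hvacRight, zero_add, expCoeff_zero, expCoeff_one, one_smul] at h
  rw [h, htrans]

theorem gg_T
    (D : Module.End ℂ V) (vac : V) (Y : V → V → ℤ → V) (Nf : V → V → ℕ)
    (hfield : ∀ (a b : V) (n : ℤ), n < -(Nf a b : ℤ) → Y a b n = 0)
    (hvacRight : ∀ (a : V) (n : ℤ), Y a vac n = expCoeff D a n)
    (htrans : ∀ (a b : V) (n : ℤ),
      D (Y a b n) - Y a (D b) n = (n + 1) • Y a b (n + 1))
    (hloc : ∀ a b : V, ∃ N : ℕ, (dl V ^ N) (ff Y vac a b - gg Y vac a b) = 0)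
    (a b : V) : t1 D (gg Y vac a b) - d2 V (gg Y vac a b) = 0 := by
  rw [← gg_D D vac Y Nf hfield hvacRight htrans hloc, sub_eq_zero]
  funext m n
  rw [d2_apply]
  exact Y_D_left D vac Y Nf hfield hvacRight htrans hloc _ _ _

theorem ff_T
    (D : Module.End ℂ V) (vac : V) (Y : V → V → ℤ → V) (Nf : V → V → ℕ)
    (hfield : ∀ (a b : V) (n : ℤ), n < -(Nf a b : ℤ) → Y a b n = 0)
    (hvacRight : ∀ (a : V) (n : ℤ), Y a vac n = expCoeff D a n)
    (htrans : ∀ (a b : V) (n : ℤ),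
      D (Y a b n) - Y a (D b) n = (n + 1) • Y a b (n + 1))
    (hloc : ∀ a b : V, ∃ N : ℕ, (dl V ^ N) (ff Y vac a b - gg Y vac a b) = 0)
    (a b : V) : t1 D (ff Y vac a b) - d2 V (ff Y vac a b) = 0 := by
  have h := gg_T D vac Y Nf hfield hvacRight htrans hloc b a
  funext m n
  have h2 := congrFun (congrFun h n) m
  simp only [Pi.sub_apply, t1_apply, d2_apply, Pi.zero_apply] at h2 ⊢
  change D (gg Y vac b a n m) - (m + 1) • gg Y vac b a n (m + 1)
    - (n + 1) • gg Y vac b a (n + 1) m = 0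
  rw [← h2]
  abel

theorem skew
    (D : Module.End ℂ V) (vac : V) (Y : V → V → ℤ → V) (Nf : V → V → ℕ)
    (hfield : ∀ (a b : V) (n : ℤ), n < -(Nf a b : ℤ) → Y a b n = 0)
    (hvacRight : ∀ (a : V) (n : ℤ), Y a vac n = expCoeff D a n)
    (htrans : ∀ (a b : V) (n : ℤ),
      D (Y a b n) - Y a (D b) n = (n + 1) • Y a b (n + 1))
    (hloc : ∀ a b : V, ∃ N : ℕ, (dl V ^ N) (ff Y vac a b - gg Y vac a b) = 0)
    (a b : V) (n : ℤ) : X2coeff D Y a b 0 n = Y b a n := by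
  obtain ⟨N, hN⟩ := hloc a b
  rw [map_sub, sub_eq_zero] at hN
  have hs := gg_supp D vac Y Nf hfield hvacRight htrans hloc
  obtain ⟨g1, g2⟩ := dl_pow_m0 N (gg Y vac a b) (hs a b)
  obtain ⟨f1, f2⟩ := dl_pow_n0 N (ff Y vac a b) (fun m n hn => hs b a n m hn)
  have hT := dl_pow_T D N _ (ff_T D vac Y Nf hfield hvacRight htrans hloc a b)
  have eF : ∀ m, ff Y vac a b m 0 = Y a b m := by
    intro m
    simp only [ff, hvacRight, expCoeff_zero]
  have eG : ∀ m, gg Y vac a b 0 m = Y b a m := by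
    intro m
    simp only [gg, hvacRight, expCoeff_zero]
  simp only [eF] at f2
  simp only [eG] at g2
  have hA : ∀ k : ℤ, k < 0 → Y a b (k - N) = 0 := by
    intro k hk
    rw [← f2, hN, g1 _ _ hk]
  have hu := X2_unique' D (fun a b k => Y a b (k - N)) a b hA _ hT (fun m => f2 m) 0
  have hB : ∀ k : ℤ, X2coeff D (fun a b k => Y a b (k - N)) a b 0 k = (-1 : ℂ) ^ N •
      X2coeff D Y a b 0 (k - N) := by
    intro k
    unfold X2coeff
    rw [if_pos le_rfl, if_pos le_rfl, smul_finsum]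
    apply finsum_congr
    intro j
    have e : 0 + (k - N) - (j : ℤ) = 0 + k - j - N := by ring
    rw [e, smul_smul, zpow_sub₀ (by norm_num : (-1 : ℂ) ≠ 0) _ (N : ℤ), zpow_natCast]
    simp only [Int.toNat_zero, intChoose_zero]
    congr 1
    have : (-1 : ℂ) ^ N ≠ 0 := by simp
    field_simp
  have hne : (-1 : ℂ) ^ N ≠ 0 := by simp
  apply smul_right_injective V hne
  have e : n = (n + N) - N := by ring
  change (-1 : ℂ) ^ N • X2coeff D Y a b 0 n = (-1 : ℂ) ^ N • Y b a n
  rw [e, ← hB, ← g2, ← hN]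
  rcases lt_or_ge (n + N) 0 with h | h
  · rw [f1 _ _ h]
    unfold X2coeff
    rw [if_pos le_rfl]
    apply finsum_eq_zero_of_forall_eq_zero
    intro j
    change _ • (D ^ j) (Y a b (0 + (n + N) - (j : ℤ) - N)) = 0
    rw [hA _ (by omega), map_zero, smul_zero]
  · have := hu (n + N).toNat
    rwa [Int.toNat_of_nonneg h] at this

end Helpers

/- STATEMENT 10: i_{z2;z1} X_{z1,z2}(a⊗b) = Y(b,z2) Y(a,z1) 1.  The coefficient of
z1^m z2^n on the right-hand side is `Y b (Y a vac m) n`. -/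
theorem stmt10
    {V : Type*} [AddCommGroup V] [Module ℂ V]
    (D : Module.End ℂ V) (vac : V) (Y : V → V → ℤ → V)
    (Nf : V → V → ℕ)
    (hfield : ∀ (a b : V) (n : ℤ), n < -(Nf a b : ℤ) → Y a b n = 0)
    (hvacLeft : ∀ (b : V) (n : ℤ), Y vac b n = if n = 0 then b else 0)
    (hvacRight : ∀ (a : V) (n : ℤ), Y a vac n = expCoeff D a n)
    (htrans : ∀ (a b : V) (n : ℤ),
      D (Y a b n) - Y a (D b) n = (n + 1) • Y a b (n + 1))
    (hcomm : ∀ a b : V, ∃ N : ℕ, ∀ (c : V) (m n : ℤ),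
      ∑ l ∈ Finset.range (N + 1), ((-1 : ℂ) ^ l * (N.choose l : ℂ)) •
        (Y a (Y b c (n - (l : ℤ))) (m - ((N - l : ℕ) : ℤ)) -
         Y b (Y a c (m - ((N - l : ℕ) : ℤ))) (n - (l : ℤ))) = 0)
    :
    ∀ (a b : V) (m n : ℤ), X2coeff D Y a b m n = Y b (Y a vac m) n := by
  have hloc : ∀ a b : V, ∃ N : ℕ, (dl V ^ N) (ff Y vac a b - gg Y vac a b) = 0 := by
    intro a b
    obtain ⟨N, hN⟩ := hcomm a b
    refine ⟨N, ?_⟩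
    funext m n
    rw [dl_pow_apply]
    exact hN vac m n
  intro a b m n
  rcases lt_or_ge m 0 with hm | hm
  · have h := gg_supp D vac Y Nf hfield hvacRight htrans hloc a b m n hm
    unfold X2coeff
    rw [if_neg (by omega)]
    exact h.symm
  · obtain ⟨k, rfl⟩ := Int.eq_ofNat_of_zero_le hm
    refine X2_unique D Y a b (Nf a b) (hfield a b) (gg Y vac a b)
      (gg_T D vac Y Nf hfield hvacRight htrans hloc a b) ?_ k n
    intro n
    rw [skew D vac Y Nf hfield hvacRight htrans hloc]
    simp only [gg, hvacRight, expCoeff_zero]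

end
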